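/- Let F : D → C be a Grothendieck opfibration such that for every c ∈ C the nerve of the fiber D(c) is contractible (i.e., F is a resolution). Then for every object c ∈ C the nerve of the comma category F/c is contractible. -/

import Mathlib

open CategoryTheory

universe v₁ u₁ v₂ u₂ v₃ u₃

section FibDefs

variable {E : Type u₁} [Category.{v₁} E] {C : Type u₂} [Category.{v₂} C]

/-- `α : x ⟶ y` is `p`-opCartesian. -/
def IsOpCart (p : E ⥤ C) {x y : E} (α : x ⟶ y) : Prop :=
  ∀ ⦃z : E⦄ (β : x ⟶ z) (h : p.obj z = p.obj y),
    p.map β ≫ eqToHom h = p.map α →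
      ∃! γ : y ⟶ z, α ≫ γ = β ∧ p.map γ = eqToHom h.symm

/-- `α : x ⟶ y` is `p`-Cartesian. -/
def IsCart (p : E ⥤ C) {x y : E} (α : x ⟶ y) : Prop :=
  ∀ ⦃z : E⦄ (β : z ⟶ y) (h : p.obj z = p.obj x),
    eqToHom h ≫ p.map α = p.map β →
      ∃! γ : z ⟶ x, γ ≫ α = β ∧ p.map γ = eqToHom h

/-- `p : E ⥤ C` is a Grothendieck opfibration. -/
structure IsOpFibration (p : E ⥤ C) : Prop where
  lift : ∀ ⦃a b : C⦄ (f : a ⟶ b) (x : E) (hx : p.obj x = a),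
    ∃ (y : E) (α : x ⟶ y) (hy : p.obj y = b),
      IsOpCart p α ∧ p.map α = eqToHom hx ≫ f ≫ eqToHom hy.symm
  comp : ∀ ⦃x y z : E⦄ (α : x ⟶ y) (β : y ⟶ z),
    IsOpCart p α → IsOpCart p β → IsOpCart p (α ≫ β)

/-- `p : E ⥤ C` is a Grothendieck fibration. -/
structure IsFibration (p : E ⥤ C) : Prop where
  lift : ∀ ⦃a b : C⦄ (f : a ⟶ b) (y : E) (hy : p.obj y = b),
    ∃ (x : E) (α : x ⟶ y) (hx : p.obj x = a),
      IsCart p α ∧ p.map α = eqToHom hx ≫ f ≫ eqToHom hy.symm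
  comp : ∀ ⦃x y z : E⦄ (α : x ⟶ y) (β : y ⟶ z),
    IsCart p α → IsCart p β → IsCart p (α ≫ β)

end FibDefs

section Stmt12

/-- The fiber of `F : D ⥤ C` over `c : C`. -/
def Fib {D : Type u₁} [Category.{v₁} D] {C : Type u₂} [Category.{v₂} C]
    (F : D ⥤ C) (c : C) := {x : D // F.obj x = c}

instance {D : Type u₁} [Category.{v₁} D] {C : Type u₂} [Category.{v₂} C]
    (F : D ⥤ C) (c : C) : Category (Fib F c) where
  Hom x y := {f : x.1 ⟶ y.1 // F.map f = eqToHom (x.2.trans y.2.symm)}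
  id x := ⟨𝟙 x.1, by simp⟩
  comp {x y z} f g := ⟨f.1 ≫ g.1, by simp [f.2, g.2]⟩
  id_comp f := by apply Subtype.ext; simp
  comp_id f := by apply Subtype.ext; simp
  assoc f g h := by apply Subtype.ext; simp

end Stmt12

namespace PrismSplit

open Finset FunOnFinite

lemma linearMap_congr_of_support {ι κ : Type*} [Finite ι] [Finite κ] {f g : ι → κ} {v : ι → ℝ}
    (h : ∀ i, v i ≠ 0 → f i = g i) : linearMap ℝ ℝ f v = linearMap ℝ ℝ g v := by
  classical
  have := Fintype.ofFinite ι
  ext k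
  simp only [linearMap_apply_apply, sum_filter]
  refine sum_congr rfl fun i _ ↦ ?_
  by_cases hi : v i = 0
  · simp [hi]
  · rw [h i hi]

lemma sum_filter_linearMap {ι κ : Type*} [Fintype ι] [Fintype κ] (f : ι → κ) (v : ι → ℝ)
    (p : κ → Prop) [DecidablePred p] :
    ∑ k with p k, linearMap ℝ ℝ f v k = ∑ i with p (f i), v i := by
  classical
  simp only [linearMap_apply_apply]
  rw [← sum_fiberwise_of_maps_to (s := univ.filter fun i ↦ p (f i)) (t := univ.filter p) (g := f)
    (by simp)]
  refine sum_congr rfl fun k hk ↦ sum_congr ?_ fun _ _ ↦ rfl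
  ext i
  simp only [mem_filter, mem_univ, true_and] at hk ⊢
  exact ⟨fun h ↦ ⟨h ▸ hk, h⟩, fun h ↦ h.2⟩

lemma sum_le_mono {ι : Type*} [Fintype ι] {t : ι → ℝ} (ht : ∀ k, 0 ≤ t k)
    {p q : ι → Prop} [DecidablePred p] [DecidablePred q] (h : ∀ i, p i → q i) :
    ∑ l with p l, t l ≤ ∑ l with q l, t l :=
  sum_le_sum_of_subset_of_nonneg (monotone_filter_right _ fun i _ ↦ h i) fun _ _ _ ↦ ht _

section

variable {ι : Type*} [Fintype ι] [LinearOrder ι]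

/-- The part below level `s` of the `k`-th weight, when the weights `t` are stacked
as consecutive intervals starting from `0`. -/
noncomputable def low (t : ι → ℝ) (s : ℝ) (k : ι) : ℝ :=
  min s (∑ l with l ≤ k, t l) - min s (∑ l with l < k, t l)

/-- The part above level `s` of the `k`-th weight. -/
noncomputable def high (t : ι → ℝ) (s : ℝ) (k : ι) : ℝ := t k - low t s k

/-- The level `s` lies in the `i`-th interval of the stack of weights `t`. -/
def Mem (t : ι → ℝ) (s : ℝ) (i : ι) : Prop :=
  ∑ l with l < i, t l ≤ s ∧ s ≤ ∑ l with l ≤ i, t l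

lemma sum_le_eq (t : ι → ℝ) (k : ι) : ∑ l with l ≤ k, t l = ∑ l with l < k, t l + t k := by
  have : univ.filter (· ≤ k) = insert k (univ.filter (· < k)) := by
    ext l; simp [le_iff_eq_or_lt]
  rw [this, sum_insert (by simp), add_comm]

lemma low_nonneg {t : ι → ℝ} (ht : ∀ k, 0 ≤ t k) (s : ℝ) (k : ι) : 0 ≤ low t s k :=
  sub_nonneg.2 (min_le_min_left _ (sum_le_mono ht fun _ ↦ le_of_lt))

lemma high_nonneg {t : ι → ℝ} (ht : ∀ k, 0 ≤ t k) (s : ℝ) (k : ι) : 0 ≤ high t s k := by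
  have := ht k
  rw [high, low, sum_le_eq]
  grind

lemma le_of_low_ne_zero {t : ι → ℝ} (ht : ∀ k, 0 ≤ t k) {s : ℝ} {i : ι} (hi : Mem t s i)
    {k : ι} (hk : low t s k ≠ 0) : k ≤ i := by
  by_contra! h
  have h₁ : ∑ l with l ≤ i, t l ≤ ∑ l with l < k, t l := sum_le_mono ht fun _ hl ↦ hl.trans_lt h
  have h₂ := ht k
  have h₃ := hi.2
  refine hk ?_
  rw [low, sum_le_eq]
  grind

lemma le_of_high_ne_zero {t : ι → ℝ} (ht : ∀ k, 0 ≤ t k) {s : ℝ} {i : ι} (hi : Mem t s i)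
    {k : ι} (hk : high t s k ≠ 0) : i ≤ k := by
  by_contra! h
  have h₁ : ∑ l with l ≤ k, t l ≤ ∑ l with l < i, t l := sum_le_mono ht fun _ hl ↦ hl.trans_lt h
  have h₂ := ht k
  have h₃ := hi.1
  refine hk ?_
  rw [high, low]
  rw [sum_le_eq] at *
  grind

lemma sum_low (t : ι → ℝ) {s : ℝ} (hs : 0 ≤ s) (L : Finset ι)
    (hL : ∀ a ∈ L, ∀ b ≤ a, b ∈ L) : ∑ k ∈ L, low t s k = min s (∑ k ∈ L, t k) := by
  induction L using Finset.induction_on_max with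
  | empty => simp [hs]
  | insert a L ha ih =>
    have h₁ : L = univ.filter (· < a) := by
      ext b
      have := hL a (mem_insert_self _ _) b
      have := ha b
      grind
    have ha' : a ∉ L := fun h ↦ lt_irrefl _ (ha a h)
    rw [sum_insert ha', sum_insert ha', ih (by subst h₁; grind), low, sum_le_eq, ← h₁,
      add_comm (t a)]
    ring

lemma linearMap_low {κ : Type*} [Fintype κ] [LinearOrder κ] {f : ι → κ} (hf : Monotone f)
    (t : ι → ℝ) {s : ℝ} (hs : 0 ≤ s) :
    linearMap ℝ ℝ f (low t s) = low (linearMap ℝ ℝ f t) s := by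
  ext k
  rw [low, sum_filter_linearMap f t (· ≤ k), sum_filter_linearMap f t (· < k),
    ← sum_low t hs, ← sum_low t hs, ← sum_filter_linearMap f (low t s) (· ≤ k),
    ← sum_filter_linearMap f (low t s) (· < k), sum_le_eq, add_sub_cancel_left]
  all_goals
    intro a ha b hab
    have := hf hab
    simp only [mem_filter, mem_univ, true_and] at ha ⊢
    order

lemma linearMap_high {κ : Type*} [Fintype κ] [LinearOrder κ] {f : ι → κ} (hf : Monotone f)
    (t : ι → ℝ) {s : ℝ} (hs : 0 ≤ s) :
    linearMap ℝ ℝ f (high t s) = high (linearMap ℝ ℝ f t) s := by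
  change linearMap ℝ ℝ f (t - low t s) = linearMap ℝ ℝ f t - low _ s
  rw [map_sub, linearMap_low hf t hs]

lemma Mem.linearMap {κ : Type*} [Fintype κ] [LinearOrder κ] {f : ι → κ} (hf : Monotone f)
    {t : ι → ℝ} (ht : ∀ k, 0 ≤ t k) {s : ℝ} {i : ι} (hi : Mem t s i) :
    Mem (linearMap ℝ ℝ f t) s (f i) := by
  rw [Mem, sum_filter_linearMap f t (· < f i), sum_filter_linearMap f t (· ≤ f i)]
  exact ⟨(sum_le_mono ht fun _ h ↦ hf.reflect_lt h).trans hi.1,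
    hi.2.trans (sum_le_mono ht fun _ h ↦ hf h)⟩

lemma low_zero {t : ι → ℝ} (ht : ∀ k, 0 ≤ t k) : low t 0 = 0 := by
  ext k
  simp [low, sum_nonneg, ht]

lemma low_one {t : ι → ℝ} (ht : t ∈ stdSimplex ℝ ι) : low t 1 = t := by
  have h (p : ι → Prop) [DecidablePred p] : ∑ l with p l, t l ≤ 1 :=
    ht.2 ▸ sum_le_sum_of_subset_of_nonneg (filter_subset _ _) fun _ _ _ ↦ ht.1 _
  ext k
  rw [low, min_eq_right (h _), min_eq_right (h _), sum_le_eq, add_sub_cancel_left]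

lemma isClosed_setOf_mem (i : ι) : IsClosed {x : (ι → ℝ) × ℝ | Mem x.1 x.2 i} := by
  have h (p : ι → Prop) [DecidablePred p] :
      Continuous fun x : (ι → ℝ) × ℝ ↦ ∑ l with p l, x.1 l :=
    continuous_finsetSum _ fun l _ ↦ (continuous_apply l).comp continuous_fst
  exact (isClosed_le (h _) continuous_snd).inter (isClosed_le continuous_snd (h _))

lemma continuous_low (k : ι) : Continuous fun x : (ι → ℝ) × ℝ ↦ low x.1 x.2 k := by
  unfold low
  fun_prop

lemma continuous_high (k : ι) : Continuous fun x : (ι → ℝ) × ℝ ↦ high x.1 x.2 k :=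
  ((continuous_apply k).comp continuous_fst).sub (continuous_low k)

end

lemma exists_mem {n : ℕ} {t : Fin (n + 1) → ℝ} (ht : t ∈ stdSimplex ℝ (Fin (n + 1))) {s : ℝ}
    (hs : s ∈ unitInterval) : ∃ i, Mem t s i := by
  have hne : (univ.filter fun i ↦ s ≤ ∑ l with l ≤ i, t l).Nonempty :=
    ⟨Fin.last n, by simpa [Fin.le_last, ht.2] using hs.2⟩
  obtain ⟨i, hi, hmin⟩ := exists_minimal hne
  refine ⟨i, ?_, by simpa using hi⟩
  cases i using Fin.cases with
  | zero => simpa using hs.1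
  | succ i =>
    by_contra! h
    have : i.succ ≤ i.castSucc := hmin (y := i.castSucc) (by
      simpa [Fin.le_castSucc_iff] using h.le) i.castSucc_lt_succ.le
    exact absurd this (not_le.2 i.castSucc_lt_succ)

lemma mem_zero {n : ℕ} {t : Fin (n + 1) → ℝ} (ht : ∀ k, 0 ≤ t k) : Mem t 0 0 :=
  ⟨by simp, sum_nonneg fun _ _ ↦ ht _⟩

lemma mem_one {n : ℕ} {t : Fin (n + 1) → ℝ} (ht : t ∈ stdSimplex ℝ (Fin (n + 1))) :
    Mem t 1 (Fin.last n) :=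
  ⟨ht.2 ▸ sum_le_sum_of_subset_of_nonneg (filter_subset _ _) fun _ _ _ ↦ ht.1 _,
    by simp [Fin.le_last, ht.2]⟩

/-- The point of the prism `Δⁿ × [0, 1]` with coordinates `(t, s)`, seen in the coordinates
of any of the `(n + 1)`-simplices of the standard triangulation containing it. -/
noncomputable def split {n : ℕ} (t : Fin (n + 1) → ℝ) (s : ℝ) : Fin (n + 2) → ℝ :=
  linearMap ℝ ℝ Fin.castSucc (low t s) + linearMap ℝ ℝ Fin.succ (high t s)

lemma split_mem {n : ℕ} {t : Fin (n + 1) → ℝ} (ht : t ∈ stdSimplex ℝ (Fin (n + 1))) (s : ℝ) :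
    split t s ∈ stdSimplex ℝ (Fin (n + 2)) := by
  refine ⟨fun k ↦ add_nonneg ?_ ?_, ?_⟩
  · rw [linearMap_apply_apply]
    exact sum_nonneg fun _ _ ↦ low_nonneg ht.1 _ _
  · rw [linearMap_apply_apply]
    exact sum_nonneg fun _ _ ↦ high_nonneg ht.1 _ _
  · have h {f : Fin (n + 1) → Fin (n + 2)} (v : Fin (n + 1) → ℝ) :
        ∑ k, linearMap ℝ ℝ f v k = ∑ k, v k := by
      simpa using sum_filter_linearMap f v fun _ ↦ True
    simp only [split, Pi.add_apply, sum_add_distrib, h]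
    simp [high, ht.2]

lemma continuous_split (n : ℕ) :
    Continuous fun x : (Fin (n + 1) → ℝ) × ℝ ↦ split x.1 x.2 := by
  refine continuous_pi fun k ↦ ?_
  simp only [split, Pi.add_apply, linearMap_apply_apply]
  exact (continuous_finsetSum _ fun _ _ ↦ continuous_low _).add
    (continuous_finsetSum _ fun _ _ ↦ continuous_high _)

lemma linearMap_split {n m : ℕ} {t : Fin (n + 1) → ℝ} (ht : ∀ k, 0 ≤ t k)
    {s : ℝ} {i j : Fin (n + 1)} (hi : Mem t s i) (hj : Mem t s j) {f g : Fin (n + 1) → Fin (m + 1)}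
    {φ : Fin (n + 2) → Fin (m + 1)} (hf : ∀ k ≤ i, φ k.castSucc = f k)
    (hg : ∀ k, j ≤ k → φ k.succ = g k) :
    linearMap ℝ ℝ φ (split t s) =
      linearMap ℝ ℝ f (low t s) + linearMap ℝ ℝ g (high t s) := by
  have h (ψ : Fin (n + 1) → Fin (n + 2)) (v : Fin (n + 1) → ℝ) :
      linearMap ℝ ℝ φ (linearMap ℝ ℝ ψ v) = linearMap ℝ ℝ (φ ∘ ψ) v := by
    rw [linearMap_comp]; rfl
  rw [split, map_add, h, h]
  congr 1
  · exact linearMap_congr_of_support fun k hk ↦ hf k (le_of_low_ne_zero ht hi hk)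
  · exact linearMap_congr_of_support fun k hk ↦ hg k (le_of_high_ne_zero ht hj hk)

lemma split_zero {n : ℕ} {t : Fin (n + 1) → ℝ} (ht : ∀ k, 0 ≤ t k) :
    split t 0 = linearMap ℝ ℝ Fin.succ t := by
  have : high t 0 = t := by ext; simp [high, low_zero ht]
  rw [split, low_zero ht, map_zero, zero_add, this]

lemma split_one {n : ℕ} {t : Fin (n + 1) → ℝ} (ht : t ∈ stdSimplex ℝ (Fin (n + 1))) :
    split t 1 = linearMap ℝ ℝ Fin.castSucc t := by
  have : high t 1 = 0 := by ext; simp [high, low_one ht]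
  rw [split, low_one ht, this, map_zero, add_zero]

end PrismSplit

namespace SSet

open Simplicial Opposite MonoidalCategory FunOnFinite PrismSplit

universe u

/-- The characteristic map `Δⁿ → |X|` of a simplex of `X`. -/
noncomputable def charMap {X : SSet.{u}} {n : SimplexCategory} (x : X.obj (op n)) :
    C(_root_.stdSimplex ℝ (Fin (n.len + 1)), |X|) :=
  TopCat.toSSetObjEquiv _ _ ((sSetTopAdj.unit.app X).app _ x)

lemma charMap_map {X : SSet.{u}} {m n : SimplexCategory} (θ : m ⟶ n) (x : X.obj (op n))
    (u : _root_.stdSimplex ℝ (Fin (m.len + 1))) :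
    charMap (X.map θ.op x) u = charMap x (_root_.stdSimplex.map θ u) := by
  have h := ConcreteCategory.congr_hom ((sSetTopAdj.unit.app X).naturality θ.op) x
  have h' := congr_arg (fun y ↦ TopCat.toSSetObjEquiv _ _ y u) h
  exact h'

lemma map_charMap {X Y : SSet.{u}} (f : X ⟶ Y) {n : SimplexCategory} (x : X.obj (op n))
    (u : _root_.stdSimplex ℝ (Fin (n.len + 1))) :
    SSet.toTop.map f (charMap x u) = charMap (f.app _ x) u := by
  have h := ConcreteCategory.congr_hom (NatTrans.congr_app (sSetTopAdj.unit.naturality f) (op n)) x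
  have h' := congr_arg (fun y ↦ TopCat.toSSetObjEquiv _ _ y u) h
  exact h'.symm

/-- Continuous maps out of `|X|` are determined by their composites with characteristic maps. -/
lemma toTop_hom_ext {X : SSet.{u}} {Z : TopCat.{u}} {f g : |X| ⟶ Z}
    (h : ∀ (n : SimplexCategory) (x : X.obj (op n)) u, f (charMap x u) = g (charMap x u)) :
    f = g := by
  apply (sSetTopAdj.homEquiv X Z).injective
  ext n x
  apply (TopCat.toSSetObjEquiv _ _).injective
  ext u
  exact h n.unop x u

/-- The continuous map out of `|X|` glued from a compatible family on simplices. -/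
lemma exists_toTop_desc {X : SSet.{u}} {Z : TopCat.{u}}
    (f : ∀ (n : SimplexCategory) (_ : X.obj (op n)), C(_root_.stdSimplex ℝ (Fin (n.len + 1)), Z))
    (hf : ∀ (m n : SimplexCategory) (θ : m ⟶ n) (x : X.obj (op n)) u,
      f m (X.map θ.op x) u = f n x (_root_.stdSimplex.map θ u)) :
    ∃ g : |X| ⟶ Z, ∀ (n : SimplexCategory) (x : X.obj (op n)) u, g (charMap x u) = f n x u := by
  let φ : X ⟶ TopCat.toSSet.obj Z :=
    { app n := ↾fun x ↦ (TopCat.toSSetObjEquiv Z n).symm (f n.unop x)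
      naturality m n θ := by
        ext x
        apply (TopCat.toSSetObjEquiv _ _).injective
        ext u
        exact hf _ _ θ.unop x u }
  refine ⟨(sSetTopAdj.homEquiv X Z).symm φ, fun n x u ↦ ?_⟩
  have h := ConcreteCategory.congr_hom (NatTrans.congr_app
    ((sSetTopAdj.homEquiv X Z).apply_symm_apply φ) (op n)) x
  have h' := congr_arg (fun y ↦ TopCat.toSSetObjEquiv _ _ y u) h
  exact h'.trans (congr_arg (· u) ((TopCat.toSSetObjEquiv _ _).apply_symm_apply (f n x)))

section Prism

variable {X Y : SSet.{u}} (H : X ⊗ Δ[1] ⟶ Y)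

/-- The simplex of `Y` obtained by evaluating `H` on a simplex of the prism on `x`. -/
noncomputable def prism {n k : SimplexCategory} (x : X.obj (op n)) (α : k ⟶ n) (β : k ⟶ ⦋1⦌) :
    Y.obj (op k) :=
  H.app (op k) (X.map α.op x, stdSimplex.objEquiv.symm β)

lemma map_prism {n k l : SimplexCategory} (x : X.obj (op n)) (α : k ⟶ n) (β : k ⟶ ⦋1⦌)
    (θ : l ⟶ k) : Y.map θ.op (prism H x α β) = prism H x (θ ≫ α) (θ ≫ β) := by
  refine (NatTrans.naturality_apply H θ.op _).symm.trans ?_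
  simp only [prism, op_comp, Functor.map_comp]
  rfl

lemma prism_map {n m k : SimplexCategory} (x : X.obj (op n)) (θ : m ⟶ n) (α : k ⟶ m)
    (β : k ⟶ ⦋1⦌) : prism H (X.map θ.op x) α β = prism H x (α ≫ θ) β := by
  simp only [prism, op_comp, Functor.map_comp]
  rfl

/-- The `i`-th maximal simplex of the prism, projected to the base. -/
def prismFst (n : SimplexCategory) (i : Fin (n.len + 1)) : ⦋n.len + 1⦌ ⟶ n :=
  SimplexCategory.Hom.mk ⟨i.predAbove, Fin.predAbove_right_monotone i⟩

/-- The `i`-th maximal simplex of the prism, projected to the interval. -/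
def prismSnd (n : SimplexCategory) (i : Fin (n.len + 1)) : ⦋n.len + 1⦌ ⟶ ⦋1⦌ :=
  SimplexCategory.Hom.mk ⟨fun k ↦ if k ≤ i.castSucc then 0 else 1, fun a b h ↦ by
    dsimp only
    split_ifs
    · rfl
    · exact Fin.zero_le _
    · order
    · rfl⟩

/-- The endomorphism of `⦋n + 1⦌` collapsing the vertices which are not
common to the `i`-th and `j`-th maximal simplices of the prism. -/
def prismCollapse (n : SimplexCategory) (i j : Fin (n.len + 1)) :
    (⦋n.len + 1⦌ : SimplexCategory) ⟶ ⦋n.len + 1⦌ :=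
  SimplexCategory.Hom.mk ⟨fun k ↦ if i.castSucc < k ∧ k ≤ j.castSucc then j.succ else k,
    fun a b h ↦ by
      dsimp only
      split_ifs <;> grind⟩

/-- The map induced by `θ` from the `j`-th to the `θ j`-th maximal simplex of the prism. -/
def prismMap {m n : SimplexCategory} (θ : m ⟶ n) (j : Fin (m.len + 1)) :
    (⦋m.len + 1⦌ : SimplexCategory) ⟶ ⦋n.len + 1⦌ :=
  SimplexCategory.Hom.mk ⟨fun k ↦ if k ≤ j.castSucc then (θ (j.predAbove k)).castSucc
    else (θ (j.predAbove k)).succ, fun a b h ↦ by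
      have := θ.toOrderHom.monotone (Fin.predAbove_right_monotone j h)
      dsimp only
      split_ifs
      · exact this
      · exact (Fin.castSucc_le_castSucc_iff.2 this).trans (Fin.castSucc_lt_succ).le
      · order
      · exact Fin.succ_le_succ_iff.2 this⟩

lemma prismCollapse_comp_prismFst (n : SimplexCategory) {i j : Fin (n.len + 1)} (h : i ≤ j) :
    prismCollapse n i j ≫ prismFst n i = prismCollapse n i j ≫ prismFst n j := by
  ext k : 3
  change i.predAbove (if i.castSucc < k ∧ k ≤ j.castSucc then j.succ else k) =
    j.predAbove (if i.castSucc < k ∧ k ≤ j.castSucc then j.succ else k)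
  grind [Fin.predAbove]

lemma prismCollapse_comp_prismSnd (n : SimplexCategory) {i j : Fin (n.len + 1)} (h : i ≤ j) :
    prismCollapse n i j ≫ prismSnd n i = prismCollapse n i j ≫ prismSnd n j := by
  ext k : 3
  change ite ((if i.castSucc < k ∧ k ≤ j.castSucc then j.succ else k) ≤ i.castSucc) 0 1 =
    ite ((if i.castSucc < k ∧ k ≤ j.castSucc then j.succ else k) ≤ j.castSucc) 0 1
  grind

lemma prismMap_comp_prismFst {m n : SimplexCategory} (θ : m ⟶ n) (j : Fin (m.len + 1)) :
    prismMap θ j ≫ prismFst n (θ j) = prismFst m j ≫ θ := by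
  ext k : 3
  change (θ j).predAbove (if k ≤ j.castSucc then (θ (j.predAbove k)).castSucc
    else (θ (j.predAbove k)).succ) = θ (j.predAbove k)
  split_ifs with h
  · have : j.predAbove k ≤ j :=
      (Fin.predAbove_right_monotone j h).trans_eq (Fin.predAbove_castSucc_self j)
    exact Fin.predAbove_castSucc_of_le _ _ (θ.toOrderHom.monotone this)
  · have : j ≤ j.predAbove k := by grind [Fin.predAbove]
    exact Fin.predAbove_succ_of_le _ _ (θ.toOrderHom.monotone this)

lemma prismMap_comp_prismSnd {m n : SimplexCategory} (θ : m ⟶ n) (j : Fin (m.len + 1)) :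
    prismMap θ j ≫ prismSnd n (θ j) = prismSnd m j := by
  ext k : 3
  change ite ((if k ≤ j.castSucc then (θ (j.predAbove k)).castSucc
    else (θ (j.predAbove k)).succ) ≤ (θ j).castSucc) 0 1 = ite (k ≤ j.castSucc) 0 1
  split_ifs with h₁ h₂ h₂
  · rfl
  · have : j.predAbove k ≤ j :=
      (Fin.predAbove_right_monotone j h₁).trans_eq (Fin.predAbove_castSucc_self j)
    exact absurd (Fin.castSucc_le_castSucc_iff.2 (θ.toOrderHom.monotone this)) h₂
  · have : j ≤ j.predAbove k := by grind [Fin.predAbove]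
    have := (Fin.castSucc_le_castSucc_iff.2 (θ.toOrderHom.monotone this)).trans_lt
      Fin.castSucc_lt_succ
    exact absurd h₂ (not_le.2 this)
  · rfl

variable {n : SimplexCategory} (x : X.obj (op n))

/-- The point of `|Y|` with coordinates `split t s` in the `i`-th maximal simplex
of the prism on `x`. -/
noncomputable def prismPoint (i : Fin (n.len + 1))
    (p : _root_.stdSimplex ℝ (Fin (n.len + 1)) × unitInterval) : |Y| :=
  charMap (prism H x (prismFst n i) (prismSnd n i)) ⟨split p.1.1 p.2.1, split_mem p.1.2 _⟩

lemma continuous_prismPoint (i : Fin (n.len + 1)) : Continuous (prismPoint H x i) := by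
  refine (charMap _).continuous.comp (Continuous.subtype_mk ?_ _)
  exact (continuous_split n.len).comp
    (f := fun p : _root_.stdSimplex ℝ (Fin (n.len + 1)) × unitInterval ↦ (p.1.1, p.2.1))
    (by fun_prop)

lemma prismPoint_eq {i j : Fin (n.len + 1)}
    {p : _root_.stdSimplex ℝ (Fin (n.len + 1)) × unitInterval}
    (hi : Mem p.1.1 p.2.1 i) (hj : Mem p.1.1 p.2.1 j) :
    prismPoint H x i p = prismPoint H x j p := by
  wlog h : i ≤ j
  · exact (this H x hj hi (le_of_not_ge h)).symm
  have hfix : _root_.stdSimplex.map (prismCollapse n i j)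
      (⟨split p.1.1 p.2.1, split_mem p.1.2 _⟩ : _root_.stdSimplex ℝ (Fin (n.len + 1 + 1))) =
      ⟨split p.1.1 p.2.1, split_mem p.1.2 _⟩ := by
    apply Subtype.ext
    refine linearMap_split p.1.2.1 hi hj (fun k hk ↦ ?_) (fun k hk ↦ ?_)
    · exact if_neg (by grind)
    · exact if_neg (by grind)
  rw [prismPoint, prismPoint, ← hfix, ← charMap_map, ← charMap_map, map_prism, map_prism,
    prismCollapse_comp_prismFst n h, prismCollapse_comp_prismSnd n h]

lemma prismPoint_map {m : SimplexCategory} (θ : m ⟶ n) {j : Fin (m.len + 1)}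
    (t : _root_.stdSimplex ℝ (Fin (m.len + 1))) (s : unitInterval) (hj : Mem t.1 s.1 j) :
    prismPoint H (X.map θ.op x) j (t, s) =
      prismPoint H x (θ j) (_root_.stdSimplex.map θ t, s) := by
  have hθ : Monotone θ := θ.toOrderHom.monotone
  have hmap : (⟨split (_root_.stdSimplex.map θ t).1 s.1, split_mem (Subtype.prop _) _⟩ :
      _root_.stdSimplex ℝ (Fin (n.len + 1 + 1))) =
      _root_.stdSimplex.map (prismMap θ j) ⟨split t.1 s.1, split_mem t.2 _⟩ := by
    apply Subtype.ext
    refine Eq.trans ?_ (linearMap_split (f := Fin.castSucc ∘ θ) (g := Fin.succ ∘ θ)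
      t.2.1 hj hj (fun k hk ↦ ?_) (fun k hk ↦ ?_)).symm
    · rw [linearMap_comp, linearMap_comp, LinearMap.comp_apply, LinearMap.comp_apply,
        linearMap_low hθ _ s.2.1, linearMap_high hθ _ s.2.1]
      rfl
    · refine (if_pos (by grind)).trans ?_
      rw [Fin.predAbove_castSucc_of_le _ _ hk]
      rfl
    · refine (if_neg (by grind)).trans ?_
      rw [Fin.predAbove_succ_of_le _ _ hk]
      rfl
  rw [prismPoint, prismPoint, hmap, ← charMap_map, map_prism, prism_map,
    prismMap_comp_prismFst, prismMap_comp_prismSnd]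

lemma exists_prismHomotopy :
    ∃ h : C(_root_.stdSimplex ℝ (Fin (n.len + 1)) × unitInterval, |Y|),
      ∀ i p, Mem p.1.1 p.2.1 i → h p = prismPoint H x i p := by
  choose i hi using fun p : _root_.stdSimplex ℝ (Fin (n.len + 1)) × unitInterval ↦
    exists_mem p.1.2 p.2.2
  refine ⟨⟨fun p ↦ prismPoint H x (i p) p, ?_⟩, fun j p hj ↦ prismPoint_eq H x (hi p) hj⟩
  refine (locallyFinite_of_finite fun j : Fin (n.len + 1) ↦
    Set.ofPred fun p : _root_.stdSimplex ℝ (Fin (n.len + 1)) × unitInterval ↦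
      Mem p.1.1 p.2.1 j).continuous
      (Set.eq_univ_of_forall fun p ↦ Set.mem_iUnion.2 ⟨i p, hi p⟩) (fun j ↦ ?_) fun j ↦ ?_
  · exact (isClosed_setOf_mem j).preimage
      (f := fun p : _root_.stdSimplex ℝ (Fin (n.len + 1)) × unitInterval ↦ (p.1.1, p.2.1))
      (by fun_prop)
  · exact (continuous_prismPoint H x j).continuousOn.congr fun p hj ↦ prismPoint_eq H x (hi p) hj

lemma prismPoint_zero (t : _root_.stdSimplex ℝ (Fin (n.len + 1))) :
    prismPoint H x 0 (t, 0) = charMap ((ι₁ ≫ H).app _ x) t := by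
  have h : (⟨split t.1 ((0 : unitInterval) : ℝ), split_mem t.2 _⟩ :
      _root_.stdSimplex ℝ (Fin (n.len + 1 + 1))) =
      _root_.stdSimplex.map (SimplexCategory.δ (n := n.len) 0) t :=
    Subtype.ext ((split_zero t.2.1).trans rfl)
  rw [prismPoint, h]
  refine (charMap_map (m := n) (SimplexCategory.δ (n := n.len) 0) _ t).symm.trans ?_
  rw [map_prism]
  have hfst : (SimplexCategory.δ 0 : ⦋n.len⦌ ⟶ _) ≫ prismFst n 0 = 𝟙 n := by
    ext k : 3
    exact Fin.predAbove_succ_of_le 0 k (Fin.zero_le _)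
  have hsnd : (SimplexCategory.δ 0 : ⦋n.len⦌ ⟶ _) ≫ prismSnd n 0 =
      SimplexCategory.const n ⦋1⦌ 1 := by
    ext k : 3
    exact if_neg (t := 0) (not_le.2 (Fin.succ_pos k))
  refine congr_arg (charMap · t) ((congr_arg₂ (prism H x) hfst hsnd).trans ?_)
  rw [prism, op_id, X.map_id]
  rfl

lemma prismPoint_one (t : _root_.stdSimplex ℝ (Fin (n.len + 1))) :
    prismPoint H x (Fin.last _) (t, 1) = charMap ((ι₀ ≫ H).app _ x) t := by
  have h : (⟨split t.1 ((1 : unitInterval) : ℝ), split_mem t.2 _⟩ :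
      _root_.stdSimplex ℝ (Fin (n.len + 1 + 1))) =
      _root_.stdSimplex.map (SimplexCategory.δ (n := n.len) (Fin.last _)) t :=
    Subtype.ext ((split_one t.2).trans (by rw [← Fin.succAbove_last]; rfl))
  rw [prismPoint, h]
  refine (charMap_map (m := n) (SimplexCategory.δ (n := n.len) (Fin.last _)) _ t).symm.trans ?_
  rw [map_prism]
  have hfst : (SimplexCategory.δ (Fin.last _) : ⦋n.len⦌ ⟶ _) ≫ prismFst n (Fin.last _) = 𝟙 n := by
    ext k : 3
    exact (congr_arg _ (Fin.succAbove_last_apply k)).trans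
      (Fin.predAbove_castSucc_of_le _ k (Fin.le_last _))
  have hsnd : (SimplexCategory.δ (Fin.last _) : ⦋n.len⦌ ⟶ _) ≫ prismSnd n (Fin.last _) =
      SimplexCategory.const n ⦋1⦌ 0 := by
    ext k : 3
    exact if_pos ((Fin.succAbove_last_apply k).trans_le (Fin.le_last k))
  refine congr_arg (charMap · t) ((congr_arg₂ (prism H x) hfst hsnd).trans ?_)
  rw [prism, op_id, X.map_id]
  rfl

end Prism

/-- A simplicial homotopy induces a homotopy between geometric realizations. -/
theorem toTop_map_homotopic {X Y : SSet.{u}} (H : X ⊗ Δ[1] ⟶ Y) :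
    (SSet.toTop.map (ι₀ ≫ H)).hom.Homotopic (SSet.toTop.map (ι₁ ≫ H)).hom := by
  choose h hh using fun (n : SimplexCategory) (x : X.obj (op n)) ↦ exists_prismHomotopy H x
  obtain ⟨g, hg⟩ := exists_toTop_desc (Z := TopCat.of C(unitInterval, |Y|))
    (fun n x ↦ (h n x).curry) (fun m n θ x t ↦ by
      ext s
      obtain ⟨j, hj⟩ := exists_mem t.2 s.2
      exact (hh _ _ j (t, s) hj).trans ((prismPoint_map H x θ t s hj).trans
        (hh _ _ (θ j) (_root_.stdSimplex.map θ t, s)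
          (hj.linearMap θ.toOrderHom.monotone t.2.1)).symm))
  let K : C(|X| × unitInterval, |Y|) := ContinuousMap.uncurry g.hom
  have hK (s : unitInterval) (f : X ⟶ Y)
      (hf : ∀ (n : SimplexCategory) (x : X.obj (op n)) t, h n x (t, s) = charMap (f.app _ x) t)
      (z : |X|) : K (z, s) = SSet.toTop.map f z := by
    have : TopCat.ofHom (K.comp ((ContinuousMap.id _).prodMk (.const _ s))) =
        SSet.toTop.map f :=
      toTop_hom_ext fun n x t ↦ (congr_arg (· s) (hg n x t)).trans
        ((hf n x t).trans (map_charMap f x t).symm)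
    exact ConcreteCategory.congr_hom this z
  refine .symm ⟨⟨K.comp .prodSwap, fun z ↦ ?_, fun z ↦ ?_⟩⟩
  · refine hK 0 _ (fun n x t ↦ ?_) z
    exact (hh n x 0 (t, 0) (mem_zero t.2.1)).trans (prismPoint_zero H x t)
  · refine hK 1 _ (fun n x t ↦ ?_) z
    exact (hh n x (Fin.last _) (t, 1) (mem_one t.2)).trans (prismPoint_one H x t)

end SSet

section NerveHomotopy

open Simplicial MonoidalCategory

variable {A B : Type} [SmallCategory A] [SmallCategory B]

/-- The functor `A × [1] ⥤ B` determined by a natural transformation. -/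
def functorOfNatTrans {G H : A ⥤ B} (τ : G ⟶ H) : A × Fin 2 ⥤ B :=
  Functor.uncurry.obj (ComposableArrows.mk₁ τ).flip

/-- The simplicial homotopy determined by a natural transformation. -/
def nerveHomotopy {G H : A ⥤ B} (τ : G ⟶ H) : nerve A ⊗ Δ[1] ⟶ nerve B where
  app _ := ↾fun p ↦
    Functor.prod' p.1 (SSet.stdSimplex.asOrderHom p.2).monotone.functor ⋙ functorOfNatTrans τ
  naturality _ _ _ := rfl

lemma ι₀_comp_nerveHomotopy {G H : A ⥤ B} (τ : G ⟶ H) :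
    SSet.ι₀ ≫ nerveHomotopy τ = nerveMap G := by
  ext n x
  refine CategoryTheory.Functor.ext (fun _ ↦ rfl) fun _ _ f ↦ ?_
  change G.map (x.map f) ≫ 𝟙 _ = 𝟙 _ ≫ G.map (x.map f) ≫ 𝟙 _
  simp

lemma ι₁_comp_nerveHomotopy {G H : A ⥤ B} (τ : G ⟶ H) :
    SSet.ι₁ ≫ nerveHomotopy τ = nerveMap H := by
  ext n x
  refine CategoryTheory.Functor.ext (fun _ ↦ rfl) fun _ _ f ↦ ?_
  change H.map (x.map f) ≫ 𝟙 _ = 𝟙 _ ≫ H.map (x.map f) ≫ 𝟙 _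
  simp

end NerveHomotopy

section CommaCategory

variable {D C : Type} [SmallCategory D] [SmallCategory C] {F : D ⥤ C} (hF : IsOpFibration F)
  {c : C}

/-- The inclusion of the fiber over `c` in the comma category over `c`. -/
def fibInclusion (F : D ⥤ C) (c : C) : Fib F c ⥤ CostructuredArrow F c where
  obj x := CostructuredArrow.mk (eqToHom x.2)
  map {x y} f := CostructuredArrow.homMk f.1 (by simp [f.2])

lemma IsOpFibration.exists_lift (hF : IsOpFibration F) (f : CostructuredArrow F c) :
    ∃ (y : Fib F c) (α : f.left ⟶ y.1), IsOpCart F α ∧ F.map α = f.hom ≫ eqToHom y.2.symm := by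
  obtain ⟨y, α, hy, h, h'⟩ := hF.lift f.hom f.left rfl
  exact ⟨⟨y, hy⟩, α, h, by simpa using h'⟩

/-- The endpoint of a chosen op-Cartesian lift of an object of the comma category. -/
noncomputable def IsOpFibration.push (f : CostructuredArrow F c) : Fib F c :=
  (hF.exists_lift f).choose

/-- A chosen op-Cartesian lift of an object of the comma category. -/
noncomputable def IsOpFibration.pushHom (f : CostructuredArrow F c) :
    f.left ⟶ (hF.push f).1 :=
  (hF.exists_lift f).choose_spec.choose

lemma IsOpFibration.isOpCart_pushHom (f : CostructuredArrow F c) : IsOpCart F (hF.pushHom f) :=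
  (hF.exists_lift f).choose_spec.choose_spec.1

lemma IsOpFibration.map_pushHom (f : CostructuredArrow F c) :
    F.map (hF.pushHom f) = f.hom ≫ eqToHom (hF.push f).2.symm :=
  (hF.exists_lift f).choose_spec.choose_spec.2

lemma IsOpFibration.existsUnique_push {f : CostructuredArrow F c} {z : Fib F c}
    (β : f.left ⟶ z.1) (hβ : F.map β = f.hom ≫ eqToHom z.2.symm) :
    ∃! γ : hF.push f ⟶ z, hF.pushHom f ≫ γ.1 = β := by
  obtain ⟨γ, ⟨h₁, h₂⟩, h₃⟩ := hF.isOpCart_pushHom f β (z.2.trans (hF.push f).2.symm)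
    (by simp [hβ, hF.map_pushHom])
  exact ⟨⟨γ, h₂⟩, h₁, fun δ hδ ↦ Subtype.ext (h₃ _ ⟨hδ, δ.2⟩)⟩

lemma IsOpFibration.push_hom_ext {f : CostructuredArrow F c} {z : Fib F c}
    {γ δ : hF.push f ⟶ z} (h : hF.pushHom f ≫ γ.1 = hF.pushHom f ≫ δ.1) : γ = δ :=
  (hF.existsUnique_push (hF.pushHom f ≫ δ.1) (by
    rw [F.map_comp, hF.map_pushHom, δ.2]; simp)).unique h rfl

lemma IsOpFibration.exists_pushMap {f g : CostructuredArrow F c} (u : f ⟶ g) :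
    ∃ γ : hF.push f ⟶ hF.push g, hF.pushHom f ≫ γ.1 = u.left ≫ hF.pushHom g :=
  (hF.existsUnique_push _ (by rw [F.map_comp, hF.map_pushHom]; simp)).exists

/-- The left adjoint of the inclusion of the fiber in the comma category. -/
noncomputable def IsOpFibration.pushFunctor (c : C) : CostructuredArrow F c ⥤ Fib F c where
  obj f := hF.push f
  map u := (hF.exists_pushMap u).choose
  map_id f := hF.push_hom_ext ((hF.exists_pushMap (𝟙 f)).choose_spec.trans (by
    change _ = _ ≫ 𝟙 _
    simp))
  map_comp u v := hF.push_hom_ext ((hF.exists_pushMap (u ≫ v)).choose_spec.trans (by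
    change _ = _ ≫ (hF.exists_pushMap u).choose.1 ≫ (hF.exists_pushMap v).choose.1
    rw [← Category.assoc, (hF.exists_pushMap u).choose_spec, Category.assoc,
      (hF.exists_pushMap v).choose_spec]
    simp))

/-- The chosen op-Cartesian lifts form the unit of the adjunction. -/
noncomputable def IsOpFibration.pushUnit (c : C) :
    𝟭 (CostructuredArrow F c) ⟶ hF.pushFunctor c ⋙ fibInclusion F c where
  app f := CostructuredArrow.homMk (hF.pushHom f) (by
    change F.map _ ≫ eqToHom (hF.push f).2 = f.hom
    rw [hF.map_pushHom]; simp)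
  naturality f g u := by
    ext
    exact (hF.exists_pushMap u).choose_spec.symm

end CommaCategory

/-- A natural transformation from the identity to a functor which factors through a category
with contractible nerve makes the nerve contractible. -/
lemma contractibleSpace_nerve_of_natTrans {A B : Type} [SmallCategory A] [SmallCategory B]
    (L : A ⥤ B) (R : B ⥤ A) (τ : 𝟭 A ⟶ L ⋙ R)
    [ContractibleSpace (SSet.toTop.obj (nerve B))] :
    ContractibleSpace (SSet.toTop.obj (nerve A)) := by
  rw [contractible_iff_id_nullhomotopic]
  have h := SSet.toTop_map_homotopic (nerveHomotopy τ)
  rw [ι₀_comp_nerveHomotopy, ι₁_comp_nerveHomotopy] at h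
  have hid : nerveMap (𝟭 A) = 𝟙 (nerve A) := rfl
  have hcomp : nerveMap (L ⋙ R) = nerveMap L ≫ nerveMap R := rfl
  rw [hid, hcomp, CategoryTheory.Functor.map_id, CategoryTheory.Functor.map_comp,
    TopCat.hom_id, TopCat.hom_comp] at h
  obtain ⟨y, hy⟩ := ((id_nullhomotopic (SSet.toTop.obj (nerve B))).comp_right
    (SSet.toTop.map (nerveMap R)).hom).comp_left (SSet.toTop.map (nerveMap L)).hom
  exact ⟨y, h.trans hy⟩

section Stmt12

/-- If `F : D ⥤ C` is a resolution, i.e. a Grothendieck opfibration all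
of whose fibers have contractible nerves, then for every `c : C` the nerve of the comma
category `F/c` is contractible. -/
theorem stmt_12 {D C : Type} [SmallCategory D] [SmallCategory C]
    (F : D ⥤ C) (hF : IsOpFibration F)
    (hfib : ∀ c : C, ContractibleSpace (SSet.toTop.obj (nerve (Fib F c))))
    (c : C) :
    ContractibleSpace (SSet.toTop.obj (nerve (CostructuredArrow F c))) := by
  have := hfib c
  exact contractibleSpace_nerve_of_natTrans (hF.pushFunctor c) (fibInclusion F c) (hF.pushUnit c)

end Stmt12
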